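/- Fix a left-invariant proper distance d_SL on SL_{n+1}(ℝ). For every ε > 0 there exists δ > 0 such that for every standard marked convex body (Ω, x) ∈ ℰ_s and every γ ∈ Aut(Ω), if d_Ω(x, γ·x) ≤ ε then d_SL(1, γ) ≤ δ. -/

import Mathlib

open Metric MeasureTheory

noncomputable section
open scoped Classical

variable {E : Type*} [NormedAddCommGroup E] [NormedSpace ℝ E]

def chordSup (Ω : Set E) (x y : E) : ℝ := sSup {t : ℝ | x + t • (y - x) ∈ Ω}

def chordInf (Ω : Set E) (x y : E) : ℝ := sInf {t : ℝ | x + t • (y - x) ∈ Ω}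

def chordA (Ω : Set E) (x y : E) : E := x + chordSup Ω x y • (y - x)

def chordB (Ω : Set E) (x y : E) : E := x + chordInf Ω x y • (y - x)

/-- The Hilbert distance `d_Ω(x,y) = ½ log [a:b:x:y]`. -/
def hilbertDist (Ω : Set E) (x y : E) : ℝ :=
  if x = y then 0 else
    (1 / 2) * Real.log ((dist (chordA Ω x y) x * dist (chordB Ω x y) y) /
      (dist (chordA Ω x y) y * dist (chordB Ω x y) x))

variable {n : ℕ}

/-- A standard marked convex body `(Ω, O)`: bounded open convex, center of mass the
origin, inertia ellipsoid the unit ball. -/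
def IsStdBody (Ω : Set (EuclideanSpace ℝ (Fin n))) : Prop :=
  IsOpen Ω ∧ Convex ℝ Ω ∧ Bornology.IsBounded Ω ∧ Ω.Nonempty ∧
    (∫ x in Ω, x = 0) ∧
    ∀ ψ : EuclideanSpace ℝ (Fin n) →ₗ[ℝ] ℝ,
      ∫ x in Ω, (ψ x) ^ 2 = ∫ x in ball (0 : EuclideanSpace ℝ (Fin n)) 1, (ψ x) ^ 2

/-- The homogeneous lift `p ↦ (p, 1)` of a point of the standard affine chart. -/
def affLift (p : EuclideanSpace ℝ (Fin n)) : Fin (n + 1) → ℝ :=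
  Fin.snoc (EuclideanSpace.equiv (Fin n) ℝ p) 1

/-- Last homogeneous coordinate of the image of a chart point under `g ∈ SL(n+1, ℝ)`. -/
def lastCoord (g : Matrix.SpecialLinearGroup (Fin (n + 1)) ℝ)
    (p : EuclideanSpace ℝ (Fin n)) : ℝ :=
  ((g : Matrix (Fin (n + 1)) (Fin (n + 1)) ℝ).mulVec (affLift p)) (Fin.last n)

/-- The projective action of `g ∈ SL(n+1, ℝ)` on the standard affine chart of `ℙⁿ(ℝ)`. -/
def projAct (g : Matrix.SpecialLinearGroup (Fin (n + 1)) ℝ)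
    (p : EuclideanSpace ℝ (Fin n)) : EuclideanSpace ℝ (Fin n) :=
  (EuclideanSpace.equiv (Fin n) ℝ).symm fun i =>
    ((g : Matrix (Fin (n + 1)) (Fin (n + 1)) ℝ).mulVec (affLift p)) i.castSucc /
      lastCoord g p

/-- `g ∈ SL(n+1, ℝ)` is a projective automorphism of `Ω`. -/
def IsAutOn (g : Matrix.SpecialLinearGroup (Fin (n + 1)) ℝ)
    (Ω : Set (EuclideanSpace ℝ (Fin n))) : Prop :=
  (∀ p ∈ Ω, lastCoord g p ≠ 0) ∧ projAct g '' Ω = Ω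

instance : TopologicalSpace (Matrix.SpecialLinearGroup (Fin (n + 1)) ℝ) :=
  TopologicalSpace.induced
    (fun g => (g : Matrix (Fin (n + 1)) (Fin (n + 1)) ℝ)) inferInstance

/-- `d` is a left-invariant, proper, compatible distance on `SL(n+1, ℝ)`. -/
structure IsLeftInvProperDist
    (d : Matrix.SpecialLinearGroup (Fin (n + 1)) ℝ →
      Matrix.SpecialLinearGroup (Fin (n + 1)) ℝ → ℝ) : Prop where
  self : ∀ g, d g g = 0
  pos : ∀ g h, g ≠ h → 0 < d g h
  symm : ∀ g h, d g h = d h g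
  triangle : ∀ g h k, d g k ≤ d g h + d h k
  leftInv : ∀ g h k, d (g * h) (g * k) = d h k
  continuous : Continuous fun p : Matrix.SpecialLinearGroup (Fin (n + 1)) ℝ ×
    Matrix.SpecialLinearGroup (Fin (n + 1)) ℝ => d p.1 p.2
  proper : ∀ r : ℝ, IsCompact {g : Matrix.SpecialLinearGroup (Fin (n + 1)) ℝ | d 1 g ≤ r}

end

section InertiaBounds

variable {n : ℕ}

lemma integrableOn_of_continuous {F : Type*} [NormedAddCommGroup F]
    {Ω : Set (EuclideanSpace ℝ (Fin n))} (hb : Bornology.IsBounded Ω)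
    {f : EuclideanSpace ℝ (Fin n) → F} (hf : Continuous f) : IntegrableOn f Ω :=
  (hf.continuousOn.integrableOn_compact hb.isCompact_closure).mono_set subset_closure

lemma setIntegral_ball_inner_sq_le (u : EuclideanSpace ℝ (Fin n)) :
    ∫ x in ball (0 : EuclideanSpace ℝ (Fin n)) 1, (inner ℝ u x) ^ 2 ≤
      volume.real (ball (0 : EuclideanSpace ℝ (Fin n)) 1) * ‖u‖ ^ 2 := by
  have h : ∫ x in ball (0 : EuclideanSpace ℝ (Fin n)) 1, (inner ℝ u x) ^ 2 ≤
      ∫ _ in ball (0 : EuclideanSpace ℝ (Fin n)) 1, ‖u‖ ^ 2 := by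
    refine setIntegral_mono_on (integrableOn_of_continuous isBounded_ball (by fun_prop))
      (integrableOn_of_continuous isBounded_ball (by fun_prop)) measurableSet_ball ?_
    intro x hx
    rw [sq_le_sq, abs_norm]
    have hx' : ‖x‖ < 1 := by simpa using hx
    calc |inner ℝ u x| ≤ ‖u‖ * ‖x‖ := abs_real_inner_le_norm u x
      _ ≤ ‖u‖ * 1 := by gcongr
      _ = ‖u‖ := mul_one _
  simpa using h

lemma le_setIntegral_ball_inner_sq (u : EuclideanSpace ℝ (Fin n)) :
    volume.real (ball (0 : EuclideanSpace ℝ (Fin n)) (1 / 4)) / 16 * ‖u‖ ^ 2 ≤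
      ∫ x in ball (0 : EuclideanSpace ℝ (Fin n)) 1, (inner ℝ u x) ^ 2 := by
  rcases eq_or_ne u 0 with rfl | hu
  · simp
  have hu' : 0 < ‖u‖ := norm_pos_iff.2 hu
  set w : EuclideanSpace ℝ (Fin n) := (1 / (2 * ‖u‖)) • u with hw
  have hwn : ‖w‖ = 1 / 2 := by
    rw [hw, norm_smul, Real.norm_of_nonneg (by positivity)]
    field_simp
  have huw : inner ℝ u w = ‖u‖ / 2 := by
    rw [hw, inner_smul_right, real_inner_self_eq_norm_sq]
    field_simp
  have hsub : ball w (1 / 4) ⊆ ball (0 : EuclideanSpace ℝ (Fin n)) 1 :=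
    ball_subset_ball' (by rw [dist_zero_right, hwn]; norm_num)
  have h1 : ∫ x in ball w (1 / 4), (inner ℝ u x) ^ 2 ≤
      ∫ x in ball (0 : EuclideanSpace ℝ (Fin n)) 1, (inner ℝ u x) ^ 2 :=
    setIntegral_mono_set (integrableOn_of_continuous isBounded_ball (by fun_prop))
      (Filter.Eventually.of_forall fun x => sq_nonneg _) hsub.eventuallyLE
  have h2 : ∫ _ in ball w (1 / 4), (‖u‖ / 4) ^ 2 ≤
      ∫ x in ball w (1 / 4), (inner ℝ u x) ^ 2 := by
    refine setIntegral_mono_on (integrableOn_of_continuous isBounded_ball (by fun_prop))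
      (integrableOn_of_continuous isBounded_ball (by fun_prop)) measurableSet_ball ?_
    intro x hx
    have hx' : ‖x - w‖ ≤ 1 / 4 := by
      rw [← dist_eq_norm]; exact (mem_ball.1 hx).le
    have h3 : -(‖u‖ * (1 / 4)) ≤ inner ℝ u (x - w) :=
      neg_le_of_abs_le ((abs_real_inner_le_norm u (x - w)).trans (by gcongr))
    rw [inner_sub_right, huw] at h3
    gcongr
    linarith
  have h3 : volume.real (ball w (1 / 4)) =
      volume.real (ball (0 : EuclideanSpace ℝ (Fin n)) (1 / 4)) := by
    simp only [Measure.real, Measure.addHaar_ball_center]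
  rw [setIntegral_const, h3, smul_eq_mul] at h2
  linarith

lemma IsStdBody.setIntegral_inner_sq {Ω : Set (EuclideanSpace ℝ (Fin n))} (h : IsStdBody Ω)
    (u : EuclideanSpace ℝ (Fin n)) :
    ∫ x in Ω, (inner ℝ u x) ^ 2 =
      ∫ x in ball (0 : EuclideanSpace ℝ (Fin n)) 1, (inner ℝ u x) ^ 2 :=
  h.2.2.2.2.2 (innerₛₗ ℝ u)

lemma IsStdBody.setIntegral_inner {Ω : Set (EuclideanSpace ℝ (Fin n))} (h : IsStdBody Ω)
    (u : EuclideanSpace ℝ (Fin n)) : ∫ x in Ω, inner ℝ u x = 0 := by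
  have := (innerSL ℝ u).integral_comp_comm
    (integrableOn_of_continuous (F := EuclideanSpace ℝ (Fin n)) h.2.2.1 continuous_id)
  simp only [id, h.2.2.2.2.1, innerSL_apply_apply, map_zero] at this
  exact this

lemma IsStdBody.volume_pos {Ω : Set (EuclideanSpace ℝ (Fin n))} (h : IsStdBody Ω) :
    0 < volume.real Ω :=
  ENNReal.toReal_pos (h.1.measure_pos _ h.2.2.2.1).ne' h.2.2.1.measure_lt_top.ne

lemma setIntegral_midpoint_le {Ω : Set (EuclideanSpace ℝ (Fin n))} (ho : IsOpen Ω)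
    (hc : Convex ℝ Ω) (hb : Bornology.IsBounded Ω) {p : EuclideanSpace ℝ (Fin n)} (hp : p ∈ Ω)
    {f : EuclideanSpace ℝ (Fin n) → ℝ} (hf : Continuous f) (hf0 : ∀ x, 0 ≤ f x) :
    ∫ x in Ω, f ((1 / 2 : ℝ) • x + (1 / 2 : ℝ) • p) ≤ 2 ^ n * ∫ x in Ω, f x := by
  have hm := ho.measurableSet
  have hi : Integrable (Ω.indicator f) :=
    (integrable_indicator_iff hm).2 (integrableOn_of_continuous hb hf)
  have hi' : Integrable
      fun x => Ω.indicator f ((1 / 2 : ℝ) • x + (1 / 2 : ℝ) • p) :=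
    (hi.comp_add_right ((1 / 2 : ℝ) • p)).comp_smul (by norm_num)
  have h1 : ∫ x in Ω, f ((1 / 2 : ℝ) • x + (1 / 2 : ℝ) • p) ≤
      ∫ x, Ω.indicator f ((1 / 2 : ℝ) • x + (1 / 2 : ℝ) • p) := by
    rw [← integral_indicator hm]
    refine integral_mono ((integrable_indicator_iff hm).2
      (integrableOn_of_continuous hb (by fun_prop))) hi' fun x => ?_
    by_cases hx : x ∈ Ω
    · have : (1 / 2 : ℝ) • x + (1 / 2 : ℝ) • p ∈ Ω :=
        hc hx hp (by norm_num) (by norm_num) (by norm_num)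
      simp only [Set.indicator_of_mem hx, Set.indicator_of_mem this, le_refl]
    · simp only [Set.indicator_of_notMem hx]
      exact Set.indicator_nonneg (fun x _ => hf0 x) _
  have h2 := Measure.integral_comp_smul (volume : Measure (EuclideanSpace ℝ (Fin n)))
    (fun x => Ω.indicator f (x + (1 / 2 : ℝ) • p)) (1 / 2)
  rw [integral_add_right_eq_self (Ω.indicator f), integral_indicator hm] at h2
  rw [h2] at h1
  simpa using h1

/-- The squared radius of a standard body, weighted by its volume, is uniformly bounded. -/
lemma IsStdBody.norm_sq_mul_volume_le {Ω : Set (EuclideanSpace ℝ (Fin n))} (h : IsStdBody Ω)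
    {p : EuclideanSpace ℝ (Fin n)} (hp : p ∈ Ω) :
    ‖p‖ ^ 2 * volume.real Ω ≤
      2 ^ (n + 2) * volume.real (ball (0 : EuclideanSpace ℝ (Fin n)) 1) := by
  have hb := h.2.2.1
  have h1 := setIntegral_midpoint_le h.1 h.2.1 hb hp
    (f := fun x => (inner ℝ p x) ^ 2) (by fun_prop) fun x => sq_nonneg _
  have h2 := setIntegral_ball_inner_sq_le p
  rw [← h.setIntegral_inner_sq] at h2
  have h3 : ∫ x in Ω, (inner ℝ p ((1 / 2 : ℝ) • x + (1 / 2 : ℝ) • p)) ^ 2 =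
      (1 / 4) * (∫ x in Ω, (inner ℝ p x) ^ 2) + (1 / 4) * (‖p‖ ^ 4 * volume.real Ω) := by
    have e : ∀ x, (inner ℝ p ((1 / 2 : ℝ) • x + (1 / 2 : ℝ) • p)) ^ 2 =
        (1 / 4) * (inner ℝ p x) ^ 2 + ((1 / 2 * ‖p‖ ^ 2) * inner ℝ p x + 1 / 4 * ‖p‖ ^ 4) := by
      intro x
      rw [inner_add_right, inner_smul_right, inner_smul_right, real_inner_self_eq_norm_sq]
      ring
    simp_rw [e]
    rw [integral_add (integrableOn_of_continuous hb (by fun_prop))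
        (integrableOn_of_continuous hb (by fun_prop)),
      integral_add (integrableOn_of_continuous hb (by fun_prop))
        (integrableOn_of_continuous hb (by fun_prop)),
      integral_const_mul, integral_const_mul, h.setIntegral_inner, setIntegral_const, smul_eq_mul]
    ring
  have h4 : 0 ≤ ∫ x in Ω, (inner ℝ p x) ^ 2 := integral_nonneg fun x => sq_nonneg _
  rcases eq_or_ne p 0 with rfl | hp0
  · rw [norm_zero, zero_pow two_ne_zero, zero_mul]
    positivity
  have hp1 : 0 < ‖p‖ ^ 2 := by positivity
  refine le_of_mul_le_mul_left ?_ hp1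
  rw [h3] at h1
  have h5 : (2 : ℝ) ^ n * ∫ x in Ω, (inner ℝ p x) ^ 2 ≤
    2 ^ n * (volume.real (ball (0 : EuclideanSpace ℝ (Fin n)) 1) * ‖p‖ ^ 2) := by gcongr
  have h6 : ‖p‖ ^ 2 * (‖p‖ ^ 2 * volume.real Ω) = ‖p‖ ^ 4 * volume.real Ω := by ring
  rw [pow_add, h6]
  linarith

lemma IsStdBody.ball_subset {Ω : Set (EuclideanSpace ℝ (Fin n))} (h : IsStdBody Ω)
    {R : ℝ} (hR : 0 < R) (hΩ : ∀ p ∈ Ω, ‖p‖ ≤ R) {r : ℝ}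
    (hr : r * (2 * R * volume.real Ω) ≤
      volume.real (ball (0 : EuclideanSpace ℝ (Fin n)) (1 / 4)) / 16) :
    ball 0 r ⊆ Ω := by
  intro z hz
  by_contra hzΩ
  have hb := h.2.2.1
  obtain ⟨f, hf⟩ := geometric_hahn_banach_open_point h.2.1 h.1 hzΩ
  set u := (InnerProductSpace.toDual ℝ (EuclideanSpace ℝ (Fin n))).symm f with hu
  have hfu : ∀ x, f x = inner ℝ u x := fun x => by
    rw [hu, InnerProductSpace.toDual_symm_apply]
  simp only [hfu] at hf
  have hu0 : 0 < ‖u‖ := by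
    rw [norm_pos_iff]
    intro h0
    obtain ⟨x, hx⟩ := h.2.2.2.1
    simpa [h0] using hf x hx
  have h1 := le_setIntegral_ball_inner_sq u
  rw [← h.setIntegral_inner_sq] at h1
  set B := |inner ℝ u z| with hB
  have h2 : ∫ x in Ω, (inner ℝ u x) ^ 2 ≤
      ∫ x in Ω, ((R * ‖u‖) * (2 * B) - (R * ‖u‖) * inner ℝ u x) := by
    refine setIntegral_mono_on (integrableOn_of_continuous hb (by fun_prop))
      (integrableOn_of_continuous hb (by fun_prop)) h.1.measurableSet fun x hx => ?_
    have a1 : |inner ℝ u x| ≤ R * ‖u‖ :=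
      (abs_real_inner_le_norm u x).trans (by rw [mul_comm]; gcongr; exact hΩ x hx)
    have a2 : |inner ℝ u x| ≤ 2 * B - inner ℝ u x := by
      have := (hf x hx).le.trans (le_abs_self _)
      have hB0 : 0 ≤ B := abs_nonneg _
      rw [abs_le]
      constructor <;> linarith
    calc (inner ℝ u x) ^ 2 = |inner ℝ u x| * |inner ℝ u x| := by rw [← sq, sq_abs]
      _ ≤ (R * ‖u‖) * (2 * B - inner ℝ u x) := by gcongr
      _ = _ := by ring
  rw [integral_sub (integrableOn_of_continuous hb (by fun_prop))
    (integrableOn_of_continuous hb (by fun_prop)), setIntegral_const, smul_eq_mul,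
    integral_const_mul, h.setIntegral_inner] at h2
  have hV := h.volume_pos
  have hBr : B < ‖u‖ * r :=
    (abs_real_inner_le_norm u z).trans_lt (by gcongr; simpa using hz)
  have h3 : (R * ‖u‖) * (2 * B) * volume.real Ω <
      (R * ‖u‖) * (2 * (‖u‖ * r)) * volume.real Ω := by gcongr
  have h4 : (r * (2 * R * volume.real Ω)) * ‖u‖ ^ 2 ≤
      volume.real (ball (0 : EuclideanSpace ℝ (Fin n)) (1 / 4)) / 16 * ‖u‖ ^ 2 := by gcongr
  nlinarith

/-- Standard bodies are uniformly pinched between two balls centred at the origin. -/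
lemma exists_ball_subset_subset_closedBall (n : ℕ) : ∃ r R : ℝ, 0 < r ∧ 0 < R ∧
    ∀ Ω : Set (EuclideanSpace ℝ (Fin n)), IsStdBody Ω → ball 0 r ⊆ Ω ∧ ∀ p ∈ Ω, ‖p‖ ≤ R := by
  have hvol : ∀ s : ℝ, 0 < s → 0 < volume.real (ball (0 : EuclideanSpace ℝ (Fin n)) s) :=
    fun s hs => ENNReal.toReal_pos (measure_ball_pos _ _ hs).ne' measure_ball_lt_top.ne
  set c := volume.real (ball (0 : EuclideanSpace ℝ (Fin n)) (1 / 4)) / 16 with hc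
  set K := 2 ^ (n + 2) * volume.real (ball (0 : EuclideanSpace ℝ (Fin n)) 1) with hK
  have hc0 : 0 < c := div_pos (hvol _ (by norm_num)) (by norm_num)
  have hK0 : 0 < K := mul_pos (by positivity) (hvol _ one_pos)
  set W := max 1 (volume.real (closedBall (0 : EuclideanSpace ℝ (Fin n)) √K)) with hW
  have hW0 : 0 < W := lt_max_of_lt_left one_pos
  set r := c / (2 * √(K * W)) with hr
  have hr0 : 0 < r := by positivity
  set v := volume.real (ball (0 : EuclideanSpace ℝ (Fin n)) r) with hv
  have hv0 : 0 < v := hvol _ hr0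
  refine ⟨r, √(K / v), hr0, by positivity, fun Ω h => ?_⟩
  have hV := h.volume_pos
  have hfin : volume Ω ≠ ⊤ := h.2.2.1.measure_lt_top.ne
  have hrad : ∀ p ∈ Ω, ‖p‖ ≤ √(K / volume.real Ω) := fun p hp =>
    Real.le_sqrt_of_sq_le ((le_div_iff₀ hV).2 (h.norm_sq_mul_volume_le hp))
  have hVW : volume.real Ω ≤ W := by
    rcases le_total (volume.real Ω) 1 with h1 | h1
    · exact h1.trans (le_max_left _ _)
    · refine le_trans (measureReal_mono (fun p hp => ?_) measure_closedBall_lt_top.ne)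
        (le_max_right _ _)
      rw [mem_closedBall_zero_iff]
      exact (hrad p hp).trans (Real.sqrt_le_sqrt (div_le_self hK0.le h1))
  have hball : ball 0 r ⊆ Ω := by
    refine h.ball_subset (by positivity) hrad ?_
    have e : √(K / volume.real Ω) * volume.real Ω = √(K * volume.real Ω) := by
      rw [← Real.sqrt_sq hV.le, ← Real.sqrt_mul (by positivity), Real.sqrt_sq hV.le]
      congr 1
      field_simp
    calc r * (2 * √(K / volume.real Ω) * volume.real Ω)
        = r * (2 * √(K * volume.real Ω)) := by rw [mul_assoc, e]
      _ ≤ r * (2 * √(K * W)) := by gcongr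
      _ = c := by rw [hr]; field_simp
  refine ⟨hball, fun p hp => (hrad p hp).trans (Real.sqrt_le_sqrt ?_)⟩
  gcongr
  exact measureReal_mono hball hfin

end InertiaBounds

section HilbertBall

variable {E : Type*} [NormedAddCommGroup E] [NormedSpace ℝ E]

lemma Convex.ball_subset_of_smul_mem {Ω : Set E} (hc : Convex ℝ Ω) {r : ℝ}
    (hr : ball 0 r ⊆ Ω) {y : E} {t : ℝ} (ht : 1 < t) (hy : t • y ∈ Ω) :
    ball y ((1 - t⁻¹) * r) ⊆ Ω := by
  intro q hq
  have ht0 : 0 < t := one_pos.trans ht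
  have h1 : 0 < 1 - t⁻¹ := sub_pos.2 (inv_lt_one_of_one_lt₀ ht)
  have hv : (1 - t⁻¹)⁻¹ • (q - y) ∈ Ω := by
    apply hr
    rw [mem_ball_zero_iff, norm_smul, Real.norm_of_nonneg (by positivity), ← dist_eq_norm,
      inv_mul_lt_iff₀ h1]
    exact hq
  have := hc hy hv (inv_nonneg.2 ht0.le) h1.le (by ring)
  rwa [smul_smul, smul_smul, inv_mul_cancel₀ ht0.ne', mul_inv_cancel₀ h1.ne', one_smul,
    one_smul, add_sub_cancel] at this

/-- A point at bounded Hilbert distance from the origin is deep inside the body. -/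
lemma ball_subset_of_hilbertDist_le {Ω : Set E} (ho : IsOpen Ω) (hc : Convex ℝ Ω)
    (hb : Bornology.IsBounded Ω) {r : ℝ} (hr0 : 0 < r) (hr : ball 0 r ⊆ Ω) {ε : ℝ} (hε : 0 < ε)
    {y : E} (hy : y ∈ Ω) (hd : hilbertDist Ω 0 y ≤ ε) :
    ball y (r / (2 * Real.exp (2 * ε) - 1)) ⊆ Ω := by
  have hE : 1 < Real.exp (2 * ε) := Real.one_lt_exp_iff.2 (by positivity)
  set X := Real.exp (2 * ε) with hX
  rcases eq_or_ne y 0 with rfl | hy0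
  · exact (ball_subset_ball (div_le_self hr0.le (by linarith))).trans hr
  have hyn : 0 < ‖y‖ := norm_pos_iff.2 hy0
  set S : Set ℝ := {t : ℝ | t • y ∈ Ω} with hS
  have h0S : (0 : ℝ) ∈ S := by
    simpa [hS] using hr (mem_ball_self hr0)
  have h1S : (1 : ℝ) ∈ S := by simpa [hS] using hy
  have hSo : IsOpen S := ho.preimage (by fun_prop)
  have hSc : Convex ℝ S := hc.is_linear_preimage (IsLinearMap.isLinearMap_smul' y)
  obtain ⟨R, hR⟩ := hb.exists_norm_le
  have hSabs : ∀ t ∈ S, |t| ≤ R / ‖y‖ := fun t ht => by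
    have := hR _ ht
    rw [norm_smul, Real.norm_eq_abs] at this
    rwa [le_div_iff₀ hyn]
  have hSa : BddAbove S := ⟨R / ‖y‖, fun t ht => (le_abs_self t).trans (hSabs t ht)⟩
  have hSb : BddBelow S := ⟨-(R / ‖y‖), fun t ht => (abs_le.1 (hSabs t ht)).1⟩
  have hsup : 1 < sSup S := by
    obtain ⟨δ, hδ, hsub⟩ := Metric.isOpen_iff.1 hSo 1 h1S
    have : 1 + δ / 2 ∈ S := hsub (by
      rw [mem_ball, Real.dist_eq, add_sub_cancel_left, abs_of_pos (by positivity)]; linarith)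
    linarith [le_csSup hSa this]
  have hinf : sInf S < 0 := by
    obtain ⟨δ, hδ, hsub⟩ := Metric.isOpen_iff.1 hSo 0 h0S
    have : -(δ / 2) ∈ S := hsub (by
      rw [mem_ball, Real.dist_eq, sub_zero, abs_neg, abs_of_pos (by positivity)]; linarith)
    linarith [csInf_le hSb this]
  have hA : chordA Ω 0 y = sSup S • y := by simp [chordA, chordSup, hS]
  have hB : chordB Ω 0 y = sInf S • y := by simp [chordB, chordInf, hS]
  set T := sSup S with hT
  set s := sInf S with hs
  have hsub : ∀ t : ℝ, dist (t • y) y = |t - 1| * ‖y‖ := fun t => by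
    rw [dist_eq_norm, ← Real.norm_eq_abs, ← norm_smul, sub_smul, one_smul]
  rw [hilbertDist, if_neg hy0.symm, hA, hB, hsub, hsub, dist_zero_right, dist_zero_right,
    norm_smul, norm_smul, Real.norm_eq_abs, Real.norm_eq_abs, abs_of_pos (by linarith : 0 < T),
    abs_of_neg hinf, abs_of_pos (by linarith : 0 < T - 1),
    abs_of_neg (by linarith : s - 1 < 0)] at hd
  have hT1 : 0 < T - 1 := by linarith
  have hs1 : 0 < -s := by linarith
  have hs2 : 0 < -(s - 1) := by linarith
  have hT0 : 0 < T := by linarith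
  have hratio : T * ‖y‖ * (-(s - 1) * ‖y‖) / ((T - 1) * ‖y‖ * (-s * ‖y‖)) ≤ X := by
    rw [hX, ← Real.log_le_iff_le_exp (by positivity)]
    linarith
  rw [div_le_iff₀ (by positivity)] at hratio
  have hTX : T ≤ X * (T - 1) := by
    have h1 : (‖y‖ * ‖y‖ * -s) * T ≤ (‖y‖ * ‖y‖ * -s) * (X * (T - 1)) := by
      have : 0 ≤ T * (‖y‖ * ‖y‖) := by positivity
      nlinarith
    exact le_of_mul_le_mul_left h1 (by positivity)
  have htS : (1 + T) / 2 ∈ S := by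
    obtain ⟨t, ht, htT⟩ := exists_lt_of_lt_csSup ⟨_, h1S⟩ (by linarith : (1 + T) / 2 < sSup S)
    exact hSc.ordConnected.out h1S ht ⟨by linarith, htT.le⟩
  refine (ball_subset_ball ?_).trans
    (hc.ball_subset_of_smul_mem hr (by linarith : 1 < (1 + T) / 2) htS)
  rw [div_eq_inv_mul]
  gcongr
  rw [inv_le_iff_one_le_mul₀ (by linarith)]
  have h2 : 1 - ((1 + T) / 2)⁻¹ = (T - 1) / (T + 1) := by
    field_simp
    ring
  rw [h2, div_mul_eq_mul_div, le_div_iff₀ (by linarith)]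
  nlinarith

end HilbertBall

section Projective

variable {n : ℕ}

lemma affLift_comb (a b : ℝ) (hab : a + b = 1) (p q : EuclideanSpace ℝ (Fin n)) :
    affLift (a • p + b • q) = a • affLift p + b • affLift q := by
  ext j
  refine Fin.lastCases ?_ (fun i => ?_) j
  · simp [affLift, hab]
  · simp [affLift]

lemma abs_affLift_le {p : EuclideanSpace ℝ (Fin n)} {R : ℝ} (hp : ‖p‖ ≤ R) (j : Fin (n + 1)) :
    |affLift p j| ≤ R + 1 := by
  have hR : 0 ≤ R := (norm_nonneg p).trans hp
  refine Fin.lastCases ?_ (fun i => ?_) j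
  · simpa [affLift] using hR
  · have := PiLp.norm_apply_le p i
    rw [Real.norm_eq_abs] at this
    simp only [affLift, Fin.snoc_castSucc, PiLp.coe_continuousLinearEquiv]
    linarith

lemma mulVec_affLift_comb (M : Matrix (Fin (n + 1)) (Fin (n + 1)) ℝ) (a b : ℝ) (hab : a + b = 1)
    (p q : EuclideanSpace ℝ (Fin n)) :
    M.mulVec (affLift (a • p + b • q)) =
      a • M.mulVec (affLift p) + b • M.mulVec (affLift q) := by
  rw [affLift_comb a b hab, Matrix.mulVec_add, Matrix.mulVec_smul, Matrix.mulVec_smul]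

lemma lastCoord_smul_affLift_projAct (g : Matrix.SpecialLinearGroup (Fin (n + 1)) ℝ)
    {p : EuclideanSpace ℝ (Fin n)} (h : lastCoord g p ≠ 0) :
    lastCoord g p • affLift (projAct g p) =
      (g : Matrix (Fin (n + 1)) (Fin (n + 1)) ℝ).mulVec (affLift p) := by
  ext j
  refine Fin.lastCases ?_ (fun i => ?_) j
  · simp [affLift, lastCoord]
  · simp [affLift, projAct, mul_div_cancel₀ _ h]

lemma abs_entry_le_of_abs_mulVec_le {Ω : Set (EuclideanSpace ℝ (Fin n))} {r : ℝ} (hr0 : 0 < r)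
    (hr : ball 0 r ⊆ Ω) {M : Matrix (Fin (n + 1)) (Fin (n + 1)) ℝ} {K : ℝ}
    (hM : ∀ p ∈ Ω, ∀ i, |M.mulVec (affLift p) i| ≤ K) (i j : Fin (n + 1)) :
    |M i j| ≤ K * (1 + 4 / r) := by
  have h0 := hM 0 (hr (mem_ball_self hr0)) i
  have hK : 0 ≤ K := (abs_nonneg _).trans h0
  refine Fin.lastCases ?_ (fun k => ?_) j
  · have e : affLift (0 : EuclideanSpace ℝ (Fin n)) = Pi.single (Fin.last n) 1 := by
      ext l
      refine Fin.lastCases ?_ (fun m => ?_) l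
      · simp [affLift]
      · simp [affLift]
    rw [e, Matrix.mulVec_single_one, Matrix.col_apply] at h0
    exact h0.trans (le_mul_of_one_le_right hK (by linarith [show 0 < 4 / r by positivity]))
  · set q : EuclideanSpace ℝ (Fin n) := EuclideanSpace.single k (r / 2) with hq
    have h1 := hM q (hr (by
      rw [mem_ball_zero_iff, hq, PiLp.norm_single, Real.norm_of_nonneg (by positivity)]
      linarith)) i
    have e : affLift q = affLift 0 + (r / 2) • Pi.single k.castSucc 1 := by
      ext l
      refine Fin.lastCases ?_ (fun m => ?_) l
      · simp [affLift]
      · simp [affLift, hq, Pi.single_apply]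
    rw [e, Matrix.mulVec_add, Matrix.mulVec_smul, Matrix.mulVec_single_one, Pi.add_apply,
      Pi.smul_apply, Matrix.col_apply, smul_eq_mul] at h1
    have h2 : r / 2 * |M i k.castSucc| ≤ 2 * K := by
      rw [← abs_of_pos (show 0 < r / 2 by positivity), ← abs_mul]
      rw [abs_le] at *
      constructor <;> linarith [h0.1, h0.2, h1.1, h1.2]
    calc |M i k.castSucc| = (2 / r) * (r / 2 * |M i k.castSucc|) := by field_simp
      _ ≤ (2 / r) * (2 * K) := by gcongr
      _ = K * (4 / r) := by ring
      _ ≤ K * (1 + 4 / r) := by gcongr; linarith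

/-- A Harnack inequality for non-vanishing affine functions on a convex set. -/
lemma abs_le_of_ne_zero_on {E : Type*} [NormedAddCommGroup E] [NormedSpace ℝ E]
    {Ω : Set E} (hc : Convex ℝ Ω) {R s : ℝ} (hR : 0 < R) (hs : 0 < s)
    (hΩ : ∀ p ∈ Ω, ‖p‖ ≤ R) {y : E} (hy : ball y s ⊆ Ω) {L : E → ℝ}
    (hL : ∀ (a b : ℝ) (p q : E), a + b = 1 → L (a • p + b • q) = a * L p + b * L q)
    (hL0 : ∀ p ∈ Ω, L p ≠ 0) {p : E} (hp : p ∈ Ω) :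
    |L p| ≤ (1 + 4 * R / s) * |L y| := by
  have same : ∀ q ∈ Ω, ∀ q' ∈ Ω, 0 < L q → 0 < L q' := by
    intro q hq q' hq' h
    by_contra hn
    have hn' : L q' < 0 := lt_of_le_of_ne (not_lt.1 hn) (hL0 _ hq')
    have hd : 0 < L q - L q' := by linarith
    have hsum : -L q' / (L q - L q') + L q / (L q - L q') = 1 := by
      field_simp
      ring
    refine hL0 _ (hc hq hq' (div_nonneg (by linarith) hd.le) (div_nonneg h.le hd.le) hsum) ?_
    rw [hL _ _ _ _ hsum]
    ring
  have hyΩ : y ∈ Ω := hy (mem_ball_self hs)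
  set τ := s / (4 * R) with hτ
  have hτ0 : 0 < τ := by positivity
  have hqb : (1 + τ) • y + (-τ) • p ∈ Ω := by
    apply hy
    have e : (1 + τ) • y + (-τ) • p - y = τ • (y - p) := by module
    rw [mem_ball, dist_eq_norm, e, norm_smul, Real.norm_of_nonneg hτ0.le]
    calc τ * ‖y - p‖ ≤ τ * (R + R) := by
          gcongr
          exact (norm_sub_le _ _).trans (add_le_add (hΩ _ hyΩ) (hΩ _ hp))
      _ = s / 2 := by rw [hτ]; field_simp; norm_num
      _ < s := by linarith
  have e := hL (1 + τ) (-τ) y p (by ring)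
  have e1 : 1 + 4 * R / s = (1 + τ) / τ := by rw [hτ]; field_simp; ring
  rw [e1, div_mul_eq_mul_div, le_div_iff₀ hτ0]
  rcases lt_or_gt_of_ne (hL0 _ hyΩ) with h | h
  · have neg : ∀ q ∈ Ω, L q < 0 := fun q hq =>
      lt_of_le_of_ne (not_lt.1 fun h' => (same q hq y hyΩ h').not_gt h) (hL0 q hq)
    rw [abs_of_neg h, abs_of_neg (neg _ hp)]
    linarith [neg _ hqb]
  · rw [abs_of_pos h, abs_of_pos (same y hyΩ p hp h)]
    linarith [same y hyΩ _ hqb h]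

/-- Automorphisms moving the origin into the interior in a controlled way are bounded. -/
lemma IsAutOn.abs_entry_le {Ω : Set (EuclideanSpace ℝ (Fin n))} (hc : Convex ℝ Ω)
    {r R s : ℝ} (hr0 : 0 < r) (hR0 : 0 < R) (hs0 : 0 < s) (hr : ball 0 r ⊆ Ω)
    (hR : ∀ p ∈ Ω, ‖p‖ ≤ R) {g : Matrix.SpecialLinearGroup (Fin (n + 1)) ℝ} (hg : IsAutOn g Ω)
    (hs : ball (projAct g 0) s ⊆ Ω) (i j : Fin (n + 1)) :
    |(g : Matrix (Fin (n + 1)) (Fin (n + 1)) ℝ) i j| ≤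
      (1 + 4 * R / r) * (((n + 1).factorial : ℝ) *
        ((1 + 4 * R / s) * (R + 1) * (1 + 4 / r))) * (R + 1) * (1 + 4 / r) := by
  have h0Ω : (0 : EuclideanSpace ℝ (Fin n)) ∈ Ω := hr (mem_ball_self hr0)
  have hmap : ∀ p ∈ Ω, projAct g p ∈ Ω := fun p hp => hg.2 ▸ Set.mem_image_of_mem _ hp
  have hcomb : ∀ (h : Matrix.SpecialLinearGroup (Fin (n + 1)) ℝ) (a b : ℝ)
      (p q : EuclideanSpace ℝ (Fin n)), a + b = 1 →
      lastCoord h (a • p + b • q) = a * lastCoord h p + b * lastCoord h q := by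
    intro h a b p q hab
    simp [lastCoord, mulVec_affLift_comb _ a b hab]
  set ℓ := |lastCoord g 0| with hℓ
  have hℓ0 : 0 < ℓ := abs_pos.2 (hg.1 0 h0Ω)
  have hinv : ∀ p ∈ Ω, ((g⁻¹ : Matrix.SpecialLinearGroup (Fin (n + 1)) ℝ) :
      Matrix (Fin (n + 1)) (Fin (n + 1)) ℝ).mulVec (affLift (projAct g p)) =
        (lastCoord g p)⁻¹ • affLift p := by
    intro p hp
    have h1 := lastCoord_smul_affLift_projAct g (hg.1 p hp)
    rw [eq_inv_smul_iff₀ (hg.1 p hp), ← Matrix.mulVec_smul, h1, Matrix.mulVec_mulVec,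
      ← Matrix.SpecialLinearGroup.coe_mul, inv_mul_cancel, Matrix.SpecialLinearGroup.coe_one,
      Matrix.one_mulVec]
  have hinvlast : ∀ p ∈ Ω, lastCoord g⁻¹ (projAct g p) = (lastCoord g p)⁻¹ := by
    intro p hp
    rw [lastCoord, hinv p hp]
    simp [affLift]
  have hb1 : ∀ p ∈ Ω, ∀ i, |(g : Matrix (Fin (n + 1)) (Fin (n + 1)) ℝ).mulVec (affLift p) i| ≤
      (1 + 4 * R / r) * ℓ * (R + 1) := by
    intro p hp i
    rw [← lastCoord_smul_affLift_projAct g (hg.1 p hp), Pi.smul_apply, smul_eq_mul, abs_mul]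
    gcongr
    · exact abs_le_of_ne_zero_on hc hR0 hr0 hR hr (hcomb g) hg.1 hp
    · exact abs_affLift_le (hR _ (hmap p hp)) i
  have hb2 : ∀ p ∈ Ω, ∀ i, |((g⁻¹ : Matrix.SpecialLinearGroup (Fin (n + 1)) ℝ) :
      Matrix (Fin (n + 1)) (Fin (n + 1)) ℝ).mulVec (affLift p) i| ≤
      (1 + 4 * R / s) * ℓ⁻¹ * (R + 1) := by
    intro q hq i
    have hne : ∀ q ∈ Ω, lastCoord g⁻¹ q ≠ 0 := by
      intro q hq
      obtain ⟨p, hp, rfl⟩ := hg.2.symm ▸ hq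
      rw [hinvlast p hp]
      exact inv_ne_zero (hg.1 p hp)
    have hL := abs_le_of_ne_zero_on hc hR0 hs0 hR hs (hcomb g⁻¹) hne hq
    rw [hinvlast 0 h0Ω, abs_inv] at hL
    obtain ⟨p, hp, rfl⟩ := hg.2.symm ▸ hq
    rw [hinvlast p hp] at hL
    rw [hinv p hp, Pi.smul_apply, smul_eq_mul, abs_mul]
    gcongr
    exact abs_affLift_le (hR _ hp) i
  have hdet := Matrix.det_le (abv := AbsoluteValue.abs)
    (fun i j => abs_entry_le_of_abs_mulVec_le hr0 hr hb2 i j)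
  set C := (1 + 4 * R / s) * (R + 1) * (1 + 4 / r) with hC
  have hC0 : 0 < C := by positivity
  have hCe : (1 + 4 * R / s) * ℓ⁻¹ * (R + 1) * (1 + 4 / r) = C / ℓ := by
    rw [hC]; ring
  rw [hCe, Matrix.SpecialLinearGroup.det_coe, Fintype.card_fin, map_one, nsmul_eq_mul, div_pow,
    mul_div_assoc', le_div_iff₀ (by positivity), one_mul] at hdet
  have hN : (1 : ℝ) ≤ (n + 1).factorial := by exact_mod_cast (n + 1).factorial_pos
  have hℓC : ℓ ≤ (n + 1).factorial * C := by
    refine le_of_pow_le_pow_left₀ (Nat.succ_ne_zero n) (by positivity) (hdet.trans ?_)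
    rw [mul_pow _ C]
    exact mul_le_mul_of_nonneg_right (le_self_pow₀ hN (Nat.succ_ne_zero n))
      (pow_nonneg hC0.le _)
  refine (abs_entry_le_of_abs_mulVec_le hr0 hr hb1 i j).trans ?_
  gcongr

lemma isCompact_setOf_abs_entry_le (n : ℕ) (M : ℝ) :
    IsCompact {g : Matrix.SpecialLinearGroup (Fin (n + 1)) ℝ |
      ∀ i j, |(g : Matrix (Fin (n + 1)) (Fin (n + 1)) ℝ) i j| ≤ M} := by
  have hind : Topology.IsInducing fun g : Matrix.SpecialLinearGroup (Fin (n + 1)) ℝ =>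
      (g : Matrix (Fin (n + 1)) (Fin (n + 1)) ℝ) := ⟨rfl⟩
  have hcl : Topology.IsClosedEmbedding fun g : Matrix.SpecialLinearGroup (Fin (n + 1)) ℝ =>
      (g : Matrix (Fin (n + 1)) (Fin (n + 1)) ℝ) := by
    refine ⟨⟨hind, Subtype.val_injective⟩, ?_⟩
    have : Set.range (fun g : Matrix.SpecialLinearGroup (Fin (n + 1)) ℝ =>
        (g : Matrix (Fin (n + 1)) (Fin (n + 1)) ℝ)) = {A | A.det = 1} := Subtype.range_val
    rw [this]
    exact isClosed_eq (Continuous.matrix_det continuous_id) continuous_const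
  have hK : IsCompact {A : Matrix (Fin (n + 1)) (Fin (n + 1)) ℝ | ∀ i j, |A i j| ≤ M} := by
    have := isCompact_univ_pi (X := fun _ : Fin (n + 1) => Fin (n + 1) → ℝ)
      fun _ : Fin (n + 1) => isCompact_univ_pi fun _ : Fin (n + 1) =>
        isCompact_Icc (a := -M) (b := M)
    refine this.of_isClosed_subset ?_ fun A hA i _ j _ => abs_le.1 (hA i j)
    simp only [Set.ofPred_forall]
    exact isClosed_iInter fun i => isClosed_iInter fun j =>
      isClosed_le (continuous_id.matrix_elem i j).abs continuous_const
  exact hcl.isCompact_preimage hK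

end Projective

/-- Fix a left-invariant proper distance `d_SL` on `SL(n+1, ℝ)`. For
every `ε > 0` there is `δ > 0` such that for every standard marked convex body `(Ω, O)`
and every `γ ∈ Aut(Ω)`: if `d_Ω(O, γ·O) ≤ ε`, then `d_SL(1, γ) ≤ δ`. -/
theorem stmt_17 (n : ℕ) (hn : 1 ≤ n)
    (dSL : Matrix.SpecialLinearGroup (Fin (n + 1)) ℝ →
      Matrix.SpecialLinearGroup (Fin (n + 1)) ℝ → ℝ)
    (hdSL : IsLeftInvProperDist dSL) :
    ∀ ε : ℝ, 0 < ε → ∃ δ : ℝ, 0 < δ ∧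
      ∀ Ω : Set (EuclideanSpace ℝ (Fin n)), IsStdBody Ω →
        ∀ γ : Matrix.SpecialLinearGroup (Fin (n + 1)) ℝ, IsAutOn γ Ω →
          hilbertDist Ω 0 (projAct γ 0) ≤ ε → dSL 1 γ ≤ δ := by
  intro ε hε
  obtain ⟨r, R, hr0, hR0, hrR⟩ := exists_ball_subset_subset_closedBall n
  set s := r / (2 * Real.exp (2 * ε) - 1) with hs
  have hs0 : 0 < s := div_pos hr0 (by linarith [Real.one_lt_exp_iff.2 (by positivity : 0 < 2 * ε)])
  set M := (1 + 4 * R / r) * (((n + 1).factorial : ℝ) *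
    ((1 + 4 * R / s) * (R + 1) * (1 + 4 / r))) * (R + 1) * (1 + 4 / r) with hM
  have hcont : Continuous fun g => dSL 1 g :=
    hdSL.continuous.comp (continuous_const.prodMk continuous_id)
  obtain ⟨δ, hδ⟩ := (isCompact_setOf_abs_entry_le n M).bddAbove_image hcont.continuousOn
  refine ⟨max δ 1, lt_max_of_lt_right one_pos, fun Ω hΩ γ hγ hd => ?_⟩
  obtain ⟨hr, hR⟩ := hrR Ω hΩ
  have hy : projAct γ 0 ∈ Ω := hγ.2 ▸ Set.mem_image_of_mem _ (hr (mem_ball_self hr0))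
  have hball := ball_subset_of_hilbertDist_le hΩ.1 hΩ.2.1 hΩ.2.2.1 hr0 hr hε hy hd
  exact le_max_of_le_left
    (hδ ⟨γ, fun i j => hγ.abs_entry_le hΩ.2.1 hr0 hR0 hs0 hr hR hball i j, rfl⟩)
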